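/- Let K be a difference subfield of U with σ(K) = K, and let a, b be finite tuples from U with σ(a) ∈ K(a)^alg and σ(b) ∈ K(b)^alg. Then dd((a,b)/K) ≥ dd(a/K(b)_σ)·dd(b/K), where dd(a/K(b)_σ) is the distant degree of a over the difference field K(b)_σ. -/

import Mathlib

/- Setting: a large algebraically closed field `U` with an automorphism `σ`.
   Tuples are maps `Fin n → U`; for a tuple `t`, the relevant set of coordinates
   is `Set.range t`.  `fAdj E s` is the subfield `E(s)` generated by a subfield
   `E` and a set `s`, and `deg E s` is the degree `μ(s/E) = [E(s):E]`. -/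

set_option maxHeartbeats 1000000
set_option synthInstance.maxHeartbeats 1000000

open Filter Set

variable {U : Type*}

/-- The subfield `E(s)` generated by the subfield `E` and the set `s`. -/
noncomputable def fAdj [Field U] (E : Subfield U) (s : Set U) : Subfield U :=
  (IntermediateField.adjoin E s).toSubfield

/-- The degree `μ(s/E) = [E(s):E]` (as `Module.finrank`; it is `0` when infinite). -/
noncomputable def deg [Field U] (E : Subfield U) (s : Set U) : ℕ :=
  Module.finrank E (IntermediateField.adjoin E s)

/-- `k ↦ μ(σ^{k+1}(s) / K(s, σ(s), …, σ^k(s)))`: the sequence whose eventual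
value is the limit degree `ld(s/K)`. -/
noncomputable def ldSeq [Field U] (σ : U ≃+* U) (K : Subfield U) (s : Set U) (k : ℕ) : ℕ :=
  deg (fAdj K (⋃ i ∈ Set.Iic k, ⇑(σ ^ i) '' s)) (⇑(σ ^ (k + 1)) '' s)

/-- `k ↦ μ(σ^k(s) / K(s))`: the sequence whose `k`-th roots converge to the
distant degree `dd(s/K)`. -/
noncomputable def ddSeq [Field U] (σ : U ≃+* U) (K : Subfield U) (s : Set U) (k : ℕ) : ℕ :=
  deg (fAdj K s) (⇑(σ ^ k) '' s)

/-- The inversive closure `K^inv = ⋃ₙ σ^{-n}(K)`. -/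
noncomputable def Kinv [Field U] (σ : U ≃+* U) (K : Subfield U) : Subfield U :=
  ⨆ n : ℕ, K.map (σ⁻¹ ^ n : U ≃+* U).toRingHom

/-- The difference field `K(s)_σ = K(σ^i(s) : i ∈ ℕ)` generated by `s` over `K`. -/
noncomputable def diffAdj [Field U] (σ : U ≃+* U) (K : Subfield U) (s : Set U) : Subfield U :=
  fAdj K (⋃ i : ℕ, ⇑(σ ^ i) '' s)

open scoped IntermediateField.algebraAdjoinAdjoin in
/-- An algebraic extension is linearly disjoint from a purely transcendental one. -/
theorem IntermediateField.linearDisjoint_adjoin_of_algebraicIndependent {F E ι : Type*}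
    [Field F] [Field E] [Algebra F E] {x : ι → E} (hx : AlgebraicIndependent F x)
    (M : IntermediateField F E) [Algebra.IsAlgebraic F M] :
    M.LinearDisjoint (IntermediateField.adjoin F (Set.range x)) := by
  have hxM : AlgebraicIndependent M x := hx.extendScalars M
  have hmono : LinearIndependent M fun s : ι →₀ ℕ => MvPolynomial.aeval x
      (MvPolynomial.monomial s (1 : M)) := by
    have := (MvPolynomial.basisMonomials ι M).linearIndependent.map'
      (MvPolynomial.aeval x).toLinearMap (LinearMap.ker_eq_bot.2 hxM)
    simpa [Function.comp_def] using this
  have hdisj : M.toSubalgebra.LinearDisjoint (Algebra.adjoin F (Set.range x)) := by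
    refine .of_basis_right _ _
      ((MvPolynomial.basisMonomials ι F).map hx.aevalEquiv.toLinearEquiv) ?_
    have hval : (Algebra.adjoin F (Set.range x)).val ∘
        ((MvPolynomial.basisMonomials ι F).map hx.aevalEquiv.toLinearEquiv) =
        fun s => MvPolynomial.aeval x (MvPolynomial.monomial s (1 : M)) := by
      ext s
      simp [MvPolynomial.aeval_monomial]
    rw [hval]
    exact hmono
  obtain ⟨κ, ⟨v⟩⟩ := Module.Basis.exists_basis F M
  refine .of_basis_left v ?_
  rw [← LinearIndependent.iff_fractionRing (R := Algebra.adjoin F (Set.range x))]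
  exact hdisj.linearIndependent_left_of_flat v.linearIndependent

theorem le_fAdj [Field U] (E : Subfield U) (s : Set U) : E ≤ fAdj E s := fun x hx =>
  (IntermediateField.adjoin E s).algebraMap_mem ⟨x, hx⟩

theorem subset_fAdj [Field U] (E : Subfield U) (s : Set U) : s ⊆ fAdj E s :=
  IntermediateField.subset_adjoin E s

theorem fAdj_le_iff [Field U] {E M : Subfield U} {s : Set U} :
    fAdj E s ≤ M ↔ E ≤ M ∧ s ⊆ M := by
  refine ⟨fun h => ⟨(le_fAdj E s).trans h, (subset_fAdj E s).trans h⟩, fun h => ?_⟩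
  refine Subfield.closure_le.2 (Set.union_subset ?_ h.2)
  rintro _ ⟨x, rfl⟩
  exact h.1 x.2

theorem fAdj_fAdj [Field U] (E : Subfield U) (s t : Set U) :
    fAdj (fAdj E s) t = fAdj E (s ∪ t) :=
  eq_of_forall_ge_iff fun M => by simp only [fAdj_le_iff, Set.union_subset_iff, and_assoc]

theorem fAdj_mono [Field U] {E E' : Subfield U} {s t : Set U} (h : E ≤ E') (hst : s ⊆ t) :
    fAdj E s ≤ fAdj E' t :=
  fAdj_le_iff.2 ⟨h.trans (le_fAdj _ _), hst.trans (subset_fAdj _ _)⟩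

theorem deg_eq_relfinrank [Field U] (E : Subfield U) (s : Set U) :
    deg E s = E.relfinrank (fAdj E s) :=
  (Subfield.relfinrank_eq_finrank_of_le (le_fAdj E s)).symm

theorem deg_union [Field U] (E : Subfield U) (s t : Set U) :
    deg E (s ∪ t) = deg E s * deg (fAdj E s) t := by
  simp only [deg_eq_relfinrank, fAdj_fAdj]
  rw [Subfield.relfinrank_mul_relfinrank (le_fAdj _ _) (fAdj_mono le_rfl Set.subset_union_left)]

theorem finiteDimensional_adjoin_of_finite [Field U] {E : Subfield U} {s : Set U} (hs : s.Finite)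
    (halg : ∀ x ∈ s, IsAlgebraic E x) : FiniteDimensional E (IntermediateField.adjoin E s) :=
  have : Finite s := hs
  IntermediateField.finiteDimensional_adjoin fun x hx => (halg x hx).isIntegral

theorem deg_pos [Field U] {E : Subfield U} {s : Set U} (hs : s.Finite)
    (halg : ∀ x ∈ s, IsAlgebraic E x) : 0 < deg E s :=
  have := finiteDimensional_adjoin_of_finite hs halg
  Module.finrank_pos

theorem IsAlgebraic.of_subfield_le [Field U] {E E' : Subfield U} (h : E ≤ E') {x : U}
    (hx : IsAlgebraic E x) : IsAlgebraic E' x := by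
  let X : IntermediateField E U := Subfield.extendScalars h
  exact hx.tower_top X

theorem adjoin_coe_adjoin [Field U] (E : Subfield U) (X : IntermediateField E U) (s : Set U) :
    IntermediateField.adjoin X (IntermediateField.adjoin E s : Set U) =
      IntermediateField.adjoin X s := by
  refine le_antisymm (IntermediateField.adjoin_le_iff.2 ?_)
    (IntermediateField.adjoin.mono _ _ _ (IntermediateField.subset_adjoin E s))
  have : IntermediateField.adjoin E s ≤ (IntermediateField.adjoin X s).restrictScalars E :=
    IntermediateField.adjoin_le_iff.2 (IntermediateField.subset_adjoin X s)
  exact this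

/-- The degree of an algebraic tuple can only drop when the base field is enlarged. -/
theorem deg_anti [Field U] {E E' : Subfield U} (h : E ≤ E') {s : Set U} (hs : s.Finite)
    (halg : ∀ x ∈ s, IsAlgebraic E x) : deg E' s ≤ deg E s := by
  have := finiteDimensional_adjoin_of_finite hs halg
  let X : IntermediateField E U := Subfield.extendScalars h
  have hle := IntermediateField.adjoin_rank_le_of_isAlgebraic_right (K := U) X
    (IntermediateField.adjoin E s)
  rw [adjoin_coe_adjoin] at hle
  exact Cardinal.toNat_le_toNat hle (Module.rank_lt_aleph0 E (IntermediateField.adjoin E s))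

/-- Adjoining a transcendental element preserves the degree of an algebraic tuple. -/
theorem deg_fAdj_singleton_of_transcendental [Field U] {E : Subfield U} {x : U}
    (hx : Transcendental E x) {s : Set U} (halg : ∀ y ∈ s, IsAlgebraic E y) :
    deg (fAdj E {x}) s = deg E s := by
  have : Algebra.IsAlgebraic E (IntermediateField.adjoin E s) :=
    IntermediateField.isAlgebraic_adjoin fun y hy => (halg y hy).isIntegral
  have hind : AlgebraicIndependent E fun _ : Unit => x :=
    algebraicIndependent_unique_type_iff.2 hx
  have hdisj := IntermediateField.linearDisjoint_adjoin_of_algebraicIndependent hind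
    (IntermediateField.adjoin E s)
  have hrank := hdisj.adjoin_rank_eq_rank_left_of_isAlgebraic_left
  rw [adjoin_coe_adjoin, Set.range_const] at hrank
  exact congrArg Cardinal.toNat hrank

/-- Adjoining finitely many elements to the base field lowers the degrees of algebraic tuples
by at most a constant factor. -/
theorem exists_deg_le_mul_deg_fAdj [Field U] {s : Set U} (hs : s.Finite) (E : Subfield U) :
    ∃ C : ℕ, 0 < C ∧ ∀ t : Set U, t.Finite → (∀ y ∈ t, IsAlgebraic E y) →
      deg E t ≤ C * deg (fAdj E s) t := by
  induction s, hs using Set.Finite.induction_on generalizing E with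
  | empty =>
    refine ⟨1, one_pos, fun t ht halg => ?_⟩
    have : fAdj E ∅ = E :=
      le_antisymm (fAdj_le_iff.2 ⟨le_rfl, Set.empty_subset _⟩) (le_fAdj _ _)
    rw [this, one_mul]
  | @insert x s _ _ ih =>
    obtain ⟨C, hC, h⟩ := ih (fAdj E {x})
    have hins : fAdj E (insert x s) = fAdj (fAdj E {x}) s := by
      rw [fAdj_fAdj, Set.singleton_union]
    have key : ∀ t : Set U, t.Finite → (∀ y ∈ t, IsAlgebraic E y) →
        deg (fAdj E {x}) t ≤ C * deg (fAdj E (insert x s)) t := fun t ht halg =>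
      hins ▸ h t ht fun y hy => (halg y hy).of_subfield_le (le_fAdj _ _)
    by_cases hx : IsAlgebraic E x
    · have hx' : ∀ y ∈ ({x} : Set U), IsAlgebraic E y := by simpa using hx
      have hdx : 0 < deg E {x} := deg_pos (Set.finite_singleton x) hx'
      refine ⟨deg E {x} * C, Nat.mul_pos hdx hC, fun t ht halg => ?_⟩
      calc deg E t ≤ deg E t * deg (fAdj E t) {x} :=
            Nat.le_mul_of_pos_right _ <| deg_pos (Set.finite_singleton x) fun y hy =>
              (hx' y hy).of_subfield_le (le_fAdj _ _)
        _ = deg E {x} * deg (fAdj E {x}) t := by rw [← deg_union, ← deg_union, Set.union_comm]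
        _ ≤ deg E {x} * C * deg (fAdj E (insert x s)) t := by
            rw [mul_assoc]
            exact Nat.mul_le_mul_left _ (key t ht halg)
    · refine ⟨C, hC, fun t ht halg => ?_⟩
      rw [← deg_fAdj_singleton_of_transcendental hx halg]
      exact key t ht halg

/-- If `σ(s)` is algebraic over `K(s)`, then so is every `σ^k(s)`. -/
theorem isAlgebraic_iterate [Field U] (σ : U ≃+* U) {K : Subfield U}
    (hK : K.map σ.toRingHom ≤ K) {s : Set U} (hs : ∀ x ∈ s, IsAlgebraic (fAdj K s) (σ x))
    (k : ℕ) {x : U} (hx : x ∈ s) : IsAlgebraic (fAdj K s) ((σ ^ k : U ≃+* U) x) := by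
  let P := algebraicClosure (fAdj K s) U
  have hKσ : ∀ y ∈ fAdj K s, σ y ∈ P := by
    suffices fAdj K s ≤ P.toSubfield.comap σ.toRingHom from this
    refine fAdj_le_iff.2 ⟨fun y hy => ?_, fun y hy => mem_algebraicClosure_iff.2 (hs y hy)⟩
    exact P.algebraMap_mem ⟨σ y, le_fAdj K s (hK ⟨y, hy, rfl⟩)⟩
  have hstep : ∀ y : U, IsAlgebraic (fAdj K s) y → IsAlgebraic (fAdj K s) (σ y) := by
    intro y hy
    let f : fAdj K s →+* P :=
      (σ.toRingHom.comp (fAdj K s).subtype).codRestrict P fun z => hKσ z z.2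
    have : IsAlgebraic P (σ.toRingHom y) :=
      hy.ringHom_of_comp_eq f σ.toRingHom f.injective rfl
    exact this.restrictScalars (fAdj K s)
  induction k with
  | zero => exact isAlgebraic_algebraMap (⟨x, subset_fAdj K s hx⟩ : fAdj K s)
  | succ k ih =>
    rw [pow_succ']
    exact hstep _ ih

/-- Up to a constant factor independent of `k`, the degrees defining `dd(a/K(b)_σ)` and `dd(b/K)`
multiply to at most those defining `dd((a,b)/K)`. -/
theorem exists_ddSeq_mul_ddSeq_le [Field U] (σ : U ≃+* U) {K : Subfield U}
    (hK : K.map σ.toRingHom ≤ K) {s t : Set U} (hs : s.Finite) (ht : t.Finite)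
    (hsa : ∀ x ∈ s, IsAlgebraic (fAdj K s) (σ x)) (hta : ∀ x ∈ t, IsAlgebraic (fAdj K t) (σ x)) :
    ∃ C : ℕ, 0 < C ∧ ∀ k : ℕ,
      ddSeq σ (diffAdj σ K t) s k * ddSeq σ K t k ≤ C * ddSeq σ K (s ∪ t) k := by
  obtain ⟨C, hC, h⟩ := exists_deg_le_mul_deg_fAdj hs (fAdj K t)
  refine ⟨C, hC, fun k => ?_⟩
  have hbase := h (⇑(σ ^ k) '' t) (ht.image _) <| by
    rintro _ ⟨x, hx, rfl⟩
    exact isAlgebraic_iterate σ hK hta k hx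
  rw [fAdj_fAdj, Set.union_comm t s] at hbase
  have htop : fAdj (fAdj K (s ∪ t)) (⇑(σ ^ k) '' t) ≤ fAdj (diffAdj σ K t) s := by
    have hpow : ∀ i : ℕ, ⇑(σ ^ i) '' t ⊆ fAdj (diffAdj σ K t) s := fun i =>
      (Set.subset_iUnion (fun i : ℕ => ⇑(σ ^ i) '' t) i).trans <|
        (subset_fAdj K _).trans (le_fAdj _ s)
    rw [fAdj_le_iff, fAdj_le_iff, Set.union_subset_iff]
    refine ⟨⟨(le_fAdj K _).trans (le_fAdj _ s), subset_fAdj _ s, ?_⟩, hpow k⟩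
    simpa using hpow 0
  have hfibre : ddSeq σ (diffAdj σ K t) s k ≤
      deg (fAdj (fAdj K (s ∪ t)) (⇑(σ ^ k) '' t)) (⇑(σ ^ k) '' s) := by
    refine deg_anti htop (hs.image _) ?_
    rintro _ ⟨x, hx, rfl⟩
    refine (isAlgebraic_iterate σ hK hsa k hx).of_subfield_le ?_
    exact (fAdj_mono le_rfl Set.subset_union_left).trans (le_fAdj _ _)
  calc ddSeq σ (diffAdj σ K t) s k * ddSeq σ K t k
      ≤ deg (fAdj (fAdj K (s ∪ t)) (⇑(σ ^ k) '' t)) (⇑(σ ^ k) '' s) *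
          (C * deg (fAdj K (s ∪ t)) (⇑(σ ^ k) '' t)) := Nat.mul_le_mul hfibre hbase
    _ = C * (deg (fAdj K (s ∪ t)) (⇑(σ ^ k) '' t) *
          deg (fAdj (fAdj K (s ∪ t)) (⇑(σ ^ k) '' t)) (⇑(σ ^ k) '' s)) := by ring
    _ = C * ddSeq σ K (s ∪ t) k := by
      rw [← deg_union, ← Set.image_union, Set.union_comm t s, ddSeq]

/-- `dd((a,b)/K) ≥ dd(a/K(b)_σ)·dd(b/K)`. -/
theorem stmt16 [Field U] [IsAlgClosed U] (σ : U ≃+* U) (K : Subfield U)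
    (hK : K.map σ.toRingHom = K) {n m : ℕ} (a : Fin n → U) (b : Fin m → U)
    (ha : ∀ i, IsAlgebraic (fAdj K (Set.range a)) (σ (a i)))
    (hb : ∀ j, IsAlgebraic (fAdj K (Set.range b)) (σ (b j)))
    (Dab Da' Db : ℝ)
    (hDab : Tendsto (fun k => (ddSeq σ K (Set.range a ∪ Set.range b) k : ℝ) ^ (1 / (k : ℝ)))
      atTop (nhds Dab))
    (hDa' : Tendsto
      (fun k => (ddSeq σ (diffAdj σ K (Set.range b)) (Set.range a) k : ℝ) ^ (1 / (k : ℝ)))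
      atTop (nhds Da'))
    (hDb : Tendsto (fun k => (ddSeq σ K (Set.range b) k : ℝ) ^ (1 / (k : ℝ)))
      atTop (nhds Db)) :
    Da' * Db ≤ Dab := by
  obtain ⟨C, hC, h⟩ := exists_ddSeq_mul_ddSeq_le σ hK.le (Set.finite_range a)
    (Set.finite_range b) (Set.forall_mem_range.2 ha) (Set.forall_mem_range.2 hb)
  have hroot : Tendsto (fun k : ℕ => (C : ℝ) ^ (1 / (k : ℝ))) atTop (nhds 1) := by
    have hcont : ContinuousAt ((C : ℝ) ^ · : ℝ → ℝ) 0 :=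
      Real.continuousAt_const_rpow (Nat.cast_ne_zero.2 hC.ne')
    simpa [Function.comp_def] using hcont.tendsto.comp (tendsto_one_div_atTop_nhds_zero_nat (𝕜 := ℝ))
  rw [← one_mul Dab]
  refine le_of_tendsto_of_tendsto' (hDa'.mul hDb) (hroot.mul hDab) fun k => ?_
  rw [← Real.mul_rpow (by positivity) (by positivity),
    ← Real.mul_rpow (by positivity) (by positivity)]
  exact Real.rpow_le_rpow (by positivity) (by exact_mod_cast h k) (by positivity)
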